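/- arXiv:1311.7057 — 9 statements merged into one kernel-verified Lean document; each statement's English description precedes it below -/
import Mathlib

section
/- Let m be any real number and define T_a : {(x,y,z,z₁,z₂) ∈ ℝ⁵ : z₂ ≠ 0} → ℝ⁵ by T_a(x, y, z, z₁, z₂) = (z₁, y, x z₁ − z, x, 1/z₂). Then for every point p with z₂ > 0, T_a(p) also has positive fifth coordinate, and the pullback along the derivative DT_a(p) of each of the three 1-forms of P_{1−m} at T_a(p) lies in the linear span of the three 1-forms of P_m at p. In other words, the Legendre transform T_a maps the Monge equation P_m to the Monge equation P_{1−m}. -/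
open Real

/-- The `i`-th coordinate projection on `ℝ⁵`, as a continuous linear map. -/
noncomputable def pr (i : Fin 5) : (Fin 5 → ℝ) →L[ℝ] ℝ :=
  ContinuousLinearMap.proj i

/-- The three 1-forms `dy - f dx`, `dz - z₁ dx`, `dz₁ - z₂ dx` at the point `p`
encoding the Monge equation `y' = f(z, z', z'')` on `ℝ⁵` with coordinates
`(x, y, z, z₁, z₂) = (p 0, p 1, p 2, p 3, p 4)`. -/
noncomputable def mongeForms (f : (Fin 5 → ℝ) → ℝ) (p : Fin 5 → ℝ) :
    Fin 3 → ((Fin 5 → ℝ) →L[ℝ] ℝ) :=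
  ![pr 1 - f p • pr 0, pr 2 - p 3 • pr 0, pr 3 - p 4 • pr 0]

/-- The Legendre transform `T_a(x, y, z, z₁, z₂) = (z₁, y, xz₁ - z, x, 1/z₂)`. -/
noncomputable def Ta : (Fin 5 → ℝ) → (Fin 5 → ℝ) :=
  fun p => ![p 3, p 1, p 0 * p 3 - p 2, p 0, (p 4)⁻¹]

/-- The derivative of the Legendre transform at a point with `z₂ ≠ 0`. -/
theorem hasFDerivAt_Ta {p : Fin 5 → ℝ} (hp : p 4 ≠ 0) :
    HasFDerivAt Ta (ContinuousLinearMap.pi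
      ![pr 3, pr 1, p 0 • pr 3 + p 3 • pr 0 - pr 2, pr 0, -(p 4 ^ 2)⁻¹ • pr 4]) p := by
  have hpr (i : Fin 5) : HasFDerivAt (fun q : Fin 5 → ℝ => q i) (pr i) p :=
    (pr i).hasFDerivAt
  rw [hasFDerivAt_pi']
  intro i
  fin_cases i
  · exact hpr 3
  · exact hpr 1
  · exact ((hpr 0).mul (hpr 3)).sub (hpr 2)
  · exact hpr 0
  · exact (hasDerivAt_inv hp).comp_hasFDerivAt p (hpr 4)

/-- The Legendre transform `T_a` maps the Monge equation `P_m : y' = (z'')^m`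
to `P_{1-m}`: it preserves `{z₂ > 0}` and the pullback along `DT_a(p)` of each
1-form of `P_{1-m}` at `T_a(p)` lies in the span of the 1-forms of `P_m` at `p`. -/
theorem legendre_maps_Pm_to_P_one_sub_m (m : ℝ) (p : Fin 5 → ℝ) (hp : p 4 > 0) :
    Ta p 4 > 0 ∧
    ∀ i : Fin 3,
      ((mongeForms (fun q => q 4 ^ (1 - m)) (Ta p) i).comp (fderiv ℝ Ta p)) ∈
        Submodule.span ℝ (Set.range (mongeForms (fun q => q 4 ^ m) p)) := by
  refine ⟨inv_pos.mpr hp, fun i => ?_⟩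
  rw [(hasFDerivAt_Ta hp.ne').fderiv]
  have hω (j : Fin 3) : mongeForms (fun q => q 4 ^ m) p j ∈
      Submodule.span ℝ (Set.range (mongeForms (fun q => q 4 ^ m) p)) :=
    Submodule.subset_span (Set.mem_range_self j)
  fin_cases i
  · have hinv : (p 4)⁻¹ ^ (1 - m) = p 4 ^ (m - 1) := by
      rw [Real.inv_rpow hp.le, ← Real.rpow_neg hp.le, neg_sub]
    have hmul : p 4 ^ m = p 4 ^ (m - 1) * p 4 := by
      rw [Real.rpow_sub_one hp.ne', div_mul_cancel₀ _ hp.ne']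
    convert Submodule.sub_mem _ (hω 0) (Submodule.smul_mem _ (p 4 ^ (m - 1)) (hω 2)) using 1
    ext1 v
    simp [mongeForms, Ta, pr, hinv, hmul]
    ring
  · convert Submodule.neg_mem _ (hω 1) using 1
    ext1 v
    simp [mongeForms, Ta, pr]
    ring
  · convert Submodule.smul_mem _ (-(p 4)⁻¹) (hω 2) using 1
    ext1 v
    simp [mongeForms, Ta, pr]
    field_simp
    ring
end

section
/- Let m > 1/2 be real and define T_b on {(x,y,z,z₁,z₂) ∈ ℝ⁵ : z₂ > 0} by T_b(x, y, z, z₁, z₂) = ( x z₂^{1−m}/√(2m−1), (m z₁ − (m−1) x z₂)/√(2m−1), z − x z₁ + (1/m) x y z₂^{1−m} + ((m−1)²/(m(2m−1))) x² z₂, (√(2m−1)/m) y − ((m−1)/(m√(2m−1))) x z₂^m, z₂^{2m−1} ). Then for every point p with z₂ > 0, T_b(p) has positive fifth coordinate, and the pullback along DT_b(p) of each of the three 1-forms of P_{m/(2m−1)} at T_b(p) lies in the linear span of the three 1-forms of P_m at p. In other words, T_b maps the Monge equation P_m to the Monge equation P_{m/(2m−1)}. -/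
open Real

/-- The transformation `T_b` (depending on the parameter `m`). -/
noncomputable def Tb (m : ℝ) : (Fin 5 → ℝ) → (Fin 5 → ℝ) :=
  fun p =>
    ![p 0 * p 4 ^ (1 - m) / Real.sqrt (2 * m - 1),
      (m * p 3 - (m - 1) * p 0 * p 4) / Real.sqrt (2 * m - 1),
      p 2 - p 0 * p 3 + (1 / m) * p 0 * p 1 * p 4 ^ (1 - m) +
        ((m - 1) ^ 2 / (m * (2 * m - 1))) * p 0 ^ 2 * p 4,
      (Real.sqrt (2 * m - 1) / m) * p 1 -
        ((m - 1) / (m * Real.sqrt (2 * m - 1))) * p 0 * p 4 ^ m,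
      p 4 ^ (2 * m - 1)]

/-- The derivative of a real power of the last coordinate, away from zero. -/
theorem hasFDerivAt_rpow_pr_four (r : ℝ) {p : Fin 5 → ℝ} (hp : p 4 > 0) :
    HasFDerivAt (fun q : Fin 5 → ℝ => q 4 ^ r) ((r * p 4 ^ (r - 1)) • pr 4) p :=
  (pr 4).hasFDerivAt.rpow_const (Or.inl hp.ne')

/-- The rows of the Jacobian of `Tb`, where `A = z₂ ^ (1 - m)` and `s = √(2 * m - 1)`. -/
noncomputable def TbRows (m : ℝ) (p : Fin 5 → ℝ) : Fin 5 → ((Fin 5 → ℝ) →L[ℝ] ℝ) :=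
  let A := p 4 ^ (1 - m)
  let s := Real.sqrt (2 * m - 1)
  ![(A / s) • pr 0 + (p 0 * ((1 - m) * p 4 ^ (1 - m - 1)) / s) • pr 4,
    (m / s) • pr 3 - ((m - 1) * p 4 / s) • pr 0 - ((m - 1) * p 0 / s) • pr 4,
    pr 2 - p 0 • pr 3 - p 3 • pr 0 + (1 / m * p 1 * A) • pr 0 + (1 / m * p 0 * A) • pr 1 +
      (1 / m * p 0 * p 1 * ((1 - m) * p 4 ^ (1 - m - 1))) • pr 4 +
      ((m - 1) ^ 2 / (m * (2 * m - 1)) * (2 * p 0) * p 4) • pr 0 +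
      ((m - 1) ^ 2 / (m * (2 * m - 1)) * p 0 ^ 2) • pr 4,
    (s / m) • pr 1 - ((m - 1) / (m * s) * p 4 ^ m) • pr 0 -
      ((m - 1) / (m * s) * p 0 * (m * p 4 ^ (m - 1))) • pr 4,
    ((2 * m - 1) * p 4 ^ (2 * m - 1 - 1)) • pr 4]

theorem hasFDerivAt_Tb (m : ℝ) {p : Fin 5 → ℝ} (hp : p 4 > 0) :
    HasFDerivAt (Tb m) (ContinuousLinearMap.pi (TbRows m p)) p := by
  have hcoord (i : Fin 5) : HasFDerivAt (fun q : Fin 5 → ℝ => q i) (pr i) p := (pr i).hasFDerivAt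
  have hpow (r : ℝ) := hasFDerivAt_rpow_pr_four r hp
  rw [hasFDerivAt_pi']
  intro i
  fin_cases i
  · refine (((hcoord 0).mul (hpow (1 - m))).mul_const (√(2 * m - 1))⁻¹).congr_fderiv ?_
    ext v
    simp [TbRows, pr]
    ring
  · refine ((((hcoord 3).const_mul m).sub
      (((hcoord 0).const_mul (m - 1)).mul (hcoord 4))).mul_const
        (√(2 * m - 1))⁻¹).congr_fderiv ?_
    ext v
    simp [TbRows, pr]
    ring
  · refine ((((hcoord 2).sub ((hcoord 0).mul (hcoord 3))).add
      ((((hcoord 0).const_mul (1 / m)).mul (hcoord 1)).mul (hpow (1 - m)))).add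
        ((((hcoord 0).pow 2).const_mul ((m - 1) ^ 2 / (m * (2 * m - 1)))).mul
          (hcoord 4))).congr_fderiv ?_
    ext v
    simp [TbRows, pr]
    ring
  · refine (((hcoord 1).const_mul (√(2 * m - 1) / m)).sub
      (((hcoord 0).const_mul ((m - 1) / (m * √(2 * m - 1)))).mul (hpow m))).congr_fderiv ?_
    ext v
    simp [TbRows, pr]
    ring
  · refine (hpow (2 * m - 1)).congr_fderiv ?_
    ext v
    simp [TbRows, pr]

/-- For `m > 1/2`, the map `T_b` maps the Monge equation `P_m : y' = (z'')^m`
to `P_{m/(2m-1)}`: it preserves `{z₂ > 0}` and the pullback along `DT_b(p)` of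
each 1-form of `P_{m/(2m-1)}` at `T_b(p)` lies in the span of the 1-forms of
`P_m` at `p`. -/
theorem Tb_maps_Pm_to_Pmu (m : ℝ) (hm : m > 1 / 2) (p : Fin 5 → ℝ) (hp : p 4 > 0) :
    Tb m p 4 > 0 ∧
    ∀ i : Fin 3,
      ((mongeForms (fun q => q 4 ^ (m / (2 * m - 1))) (Tb m p) i).comp
          (fderiv ℝ (Tb m) p)) ∈
        Submodule.span ℝ (Set.range (mongeForms (fun q => q 4 ^ m) p)) := by
  refine ⟨Real.rpow_pos_of_pos hp _, ?_⟩
  rw [(hasFDerivAt_Tb m hp).fderiv]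
  have hm0 : m ≠ 0 := by linarith
  have hk : 2 * m - 1 > 0 := by linarith
  have hs0 : √(2 * m - 1) ≠ 0 := (Real.sqrt_pos.mpr hk).ne'
  have hs2 : √(2 * m - 1) ^ 2 = 2 * m - 1 := Real.sq_sqrt hk.le
  have hu0 : p 4 ≠ 0 := hp.ne'
  have hA0 : p 4 ^ (1 - m) ≠ 0 := (Real.rpow_pos_of_pos hp _).ne'
  have hA' : p 4 ^ (-m) = p 4 ^ (1 - m) / p 4 := by
    rw [← Real.rpow_sub_one hu0]
    simp
  have hpm : p 4 ^ m = p 4 / p 4 ^ (1 - m) := by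
    rw [eq_div_iff hA0, ← Real.rpow_add hp]
    simp
  have hpm' : p 4 ^ (m - 1) = 1 / p 4 ^ (1 - m) := by
    rw [Real.rpow_sub_one hu0, hpm]
    field_simp
  have hpk : p 4 ^ (2 * m - 1) = p 4 / (p 4 ^ (1 - m)) ^ 2 := by
    have h : 2 * m - 1 = m + (m - 1) := by ring
    rw [h, Real.rpow_add hp, hpm, hpm']
    field_simp
  have hmu : (p 4 ^ (2 * m - 1)) ^ (m / (2 * m - 1)) = p 4 / p 4 ^ (1 - m) := by
    rw [← Real.rpow_mul hp.le, mul_div_cancel₀ _ hk.ne', hpm]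
  intro i
  set ω := mongeForms (fun q => q 4 ^ m) p with hω
  have hmem (j : Fin 3) : ω j ∈ Submodule.span ℝ (Set.range ω) :=
    Submodule.subset_span (Set.mem_range_self j)
  fin_cases i
  · convert Submodule.smul_mem _ (m / √(2 * m - 1)) (hmem 2) using 1
    ext v
    simp [hω, mongeForms, TbRows, Tb, pr, hmu, hA']
    generalize p 4 ^ (1 - m) = A at *
    generalize √(2 * m - 1) = s at *
    field_simp
    ring
  · convert Submodule.add_mem _ (Submodule.sub_mem _ (hmem 1) (Submodule.smul_mem _ (p 0) (hmem 2)))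
      (Submodule.smul_mem _ (p 0 * p 4 ^ (1 - m) / m) (hmem 0)) using 1
    ext v
    simp [hω, mongeForms, TbRows, Tb, pr, hpm, hA']
    generalize p 4 ^ (1 - m) = A at *
    generalize √(2 * m - 1) = s at *
    rw [← hs2]
    field_simp
    simp only [hs2]
    ring
  · convert Submodule.smul_mem _ (√(2 * m - 1) / m) (hmem 0) using 1
    ext v
    simp [hω, mongeForms, TbRows, Tb, pr, hpm, hpm', hpk, hA']
    generalize p 4 ^ (1 - m) = A at *
    generalize √(2 * m - 1) = s at *
    field_simp
    simp only [hs2]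
    ring
end

section
/- For real m > 1/2, let T_b^{(m)} be defined on {z₂ > 0} ⊂ ℝ⁵ by T_b^{(m)}(x, y, z, z₁, z₂) = ( x z₂^{1−m}/√(2m−1), (m z₁ − (m−1) x z₂)/√(2m−1), z − x z₁ + (1/m) x y z₂^{1−m} + ((m−1)²/(m(2m−1))) x² z₂, (√(2m−1)/m) y − ((m−1)/(m√(2m−1))) x z₂^m, z₂^{2m−1} ), and let μ = m/(2m−1) (which also satisfies μ > 1/2). Then T_b is an involution across the parameter exchange: for every point p ∈ ℝ⁵ with z₂ > 0, T_b^{(μ)}(T_b^{(m)}(p)) = p. -/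
open Real

/-- For `m > 1/2` and `μ = m/(2m-1)` (which also satisfies `μ > 1/2`), `T_b` is an
involution across the parameter exchange: `T_b^{(μ)} ∘ T_b^{(m)} = id` on `{z₂ > 0}`. -/
theorem Tb_involution (m : ℝ) (hm : m > 1 / 2) :
    m / (2 * m - 1) > 1 / 2 ∧
    ∀ p : Fin 5 → ℝ, p 4 > 0 → Tb (m / (2 * m - 1)) (Tb m p) = p := by
  have hd : 0 < 2 * m - 1 := by linarith
  refine ⟨by rw [gt_iff_lt, lt_div_iff₀ hd]; linarith, fun p hz => ?_⟩
  have hμ : 2 * (m / (2 * m - 1)) - 1 = (2 * m - 1)⁻¹ := by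
    field_simp
    ring
  have h_one_sub : 1 - m / (2 * m - 1) = (m - 1) / (2 * m - 1) := by
    rw [one_sub_div hd.ne']
    ring
  have h_sub_one : m / (2 * m - 1) - 1 = (1 - m) / (2 * m - 1) := by
    rw [div_sub_one hd.ne']
    ring
  have hsqrt : √((2 * m - 1)⁻¹) = (√(2 * m - 1))⁻¹ := Real.sqrt_inv _
  have hw : 0 < p 4 ^ (1 - m) := Real.rpow_pos_of_pos hz _
  have hpow_inv : (p 4 ^ (2 * m - 1)) ^ ((2 * m - 1)⁻¹) = p 4 :=
    Real.rpow_rpow_inv hz.le hd.ne'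
  have hpow_one_sub :
      (p 4 ^ (2 * m - 1)) ^ ((m - 1) / (2 * m - 1)) = (p 4 ^ (1 - m))⁻¹ := by
    rw [← Real.rpow_mul hz.le, mul_div_cancel₀ _ hd.ne', ← Real.rpow_neg hz.le, neg_sub]
  have hpow_μ : (p 4 ^ (2 * m - 1)) ^ (m / (2 * m - 1)) = p 4 / p 4 ^ (1 - m) := by
    rw [← Real.rpow_mul hz.le, mul_div_cancel₀ _ hd.ne', eq_div_iff hw.ne',
      ← Real.rpow_add hz, add_sub_cancel, Real.rpow_one]
  have hpow_m : p 4 ^ m = p 4 / p 4 ^ (1 - m) := by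
    rw [eq_div_iff hw.ne', ← Real.rpow_add hz, add_sub_cancel, Real.rpow_one]
  have hpow_two : p 4 ^ (2 * m - 1) = p 4 / (p 4 ^ (1 - m)) ^ 2 := by
    rw [eq_div_iff (by positivity), sq, ← Real.rpow_add hz, ← Real.rpow_add hz]
    ring_nf
    exact Real.rpow_one _
  have hs : 0 < √(2 * m - 1) := Real.sqrt_pos.mpr hd
  have hsq : √(2 * m - 1) ^ 2 = 2 * m - 1 := Real.sq_sqrt hd.le
  funext i
  fin_cases i <;>
    simp only [Tb, Fin.reduceFinMk, Fin.zero_eta, Fin.mk_one, Matrix.cons_val, hμ, h_one_sub,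
      h_sub_one, hsqrt, hpow_inv, hpow_one_sub, hpow_μ] <;>
    (try rw [hpow_m]) <;> (try rw [hpow_two]) <;>
    generalize p 4 ^ (1 - m) = w at * <;>
    generalize √(2 * m - 1) = s at * <;>
    (try rw [← hsq]) <;>
    obtain rfl : m = (s ^ 2 + 1) / 2 := by linarith
  all_goals
    field_simp
    try ring
end

section
/- Let m be real with m ∉ {0, 1/2, 1}, set μ = m/(2m−1), and define T_ζ on {(x,y,z,z₁,z₂) ∈ ℝ⁵ : z₂ > 0} by T_ζ(x, y, z, z₁, z₂) = ( ((2m−1)/(m−1)) y z₂^{1−m} − (m/(m−1)) z₁, y z₂^{1−2m}, (1/μ)(y² z₂^{1−2m} − x y z₂^{1−m}) + x z₁ − z, (1/μ) y z₂^{−m} − ((m−1)/m) x, 1/z₂ ). Then T_ζ maps {z₂ > 0} into itself and is an involution: T_ζ(T_ζ(p)) = p for every p with z₂ > 0. -/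
open Real

/-- The anomaly map `T_ζ = (T_a T_b)²` (depending on the parameter `m`), with
`μ = m/(2m-1)`. -/
noncomputable def Tzeta (m : ℝ) : (Fin 5 → ℝ) → (Fin 5 → ℝ) :=
  fun p =>
    ![((2 * m - 1) / (m - 1)) * p 1 * p 4 ^ (1 - m) - (m / (m - 1)) * p 3,
      p 1 * p 4 ^ (1 - 2 * m),
      (1 / (m / (2 * m - 1))) * ((p 1) ^ 2 * p 4 ^ (1 - 2 * m) - p 0 * p 1 * p 4 ^ (1 - m)) +
        p 0 * p 3 - p 2,
      (1 / (m / (2 * m - 1))) * p 1 * p 4 ^ (-m) - ((m - 1) / m) * p 0,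
      (p 4)⁻¹]

/-- For `m ∉ {0, 1/2, 1}`, the map `T_ζ` preserves `{z₂ > 0} ⊂ ℝ⁵` and is an
involution there. -/
theorem Tzeta_involution (m : ℝ) (h0 : m ≠ 0) (h12 : m ≠ 1 / 2) (h1 : m ≠ 1) :
    ∀ p : Fin 5 → ℝ, p 4 > 0 →
      Tzeta m p 4 > 0 ∧ Tzeta m (Tzeta m p) = p := by
  intro p hp
  refine ⟨by simpa [Tzeta] using hp, ?_⟩
  have hm : 2 * m - 1 ≠ 0 := fun h => h12 (by linarith)
  have hm1 : m - 1 ≠ 0 := sub_ne_zero.mpr h1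
  have ht : p 4 ≠ 0 := hp.ne'
  have ha : p 4 ^ m ≠ 0 := (rpow_pos_of_pos hp m).ne'
  have e1 : p 4 ^ (1 - m) = p 4 / p 4 ^ m := by
    rw [rpow_sub hp, rpow_one]
  have e2 : p 4 ^ (1 - 2 * m) = p 4 / (p 4 ^ m) ^ 2 := by
    rw [rpow_sub hp, rpow_one, two_mul, rpow_add hp, sq]
  have e3 : p 4 ^ (-m) = (p 4 ^ m)⁻¹ := rpow_neg hp.le m
  ext i
  fin_cases i <;> simp [Tzeta, inv_rpow hp.le, e1, e2, e3] <;> field_simp <;> ring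
end

section
/- Let m be real with m ∉ {0, 1/2, 1}, set μ = m/(2m−1), and define T_ζ on {z₂ > 0} ⊂ ℝ⁵ by T_ζ(x, y, z, z₁, z₂) = ( ((2m−1)/(m−1)) y z₂^{1−m} − (m/(m−1)) z₁, y z₂^{1−2m}, (1/μ)(y² z₂^{1−2m} − x y z₂^{1−m}) + x z₁ − z, (1/μ) y z₂^{−m} − ((m−1)/m) x, 1/z₂ ). Then T_ζ is an auto-equivalence of the Monge equation P_m: for every point p with z₂ > 0, the pullback along DT_ζ(p) of each of the three 1-forms of P_m at T_ζ(p) lies in the linear span of the three 1-forms of P_m at p. -/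
open Real

/-- The derivative of `Tzeta m` at a point with nonzero last coordinate. -/
noncomputable def TzetaDeriv (m : ℝ) (p : Fin 5 → ℝ) : (Fin 5 → ℝ) →L[ℝ] (Fin 5 → ℝ) :=
  ContinuousLinearMap.pi
    ![((2 * m - 1) / (m - 1)) • (p 4 ^ (1 - m) • pr 1 +
          (p 1 * ((1 - m) * p 4 ^ (1 - m - 1))) • pr 4) - (m / (m - 1)) • pr 3,
      p 4 ^ (1 - 2 * m) • pr 1 + (p 1 * ((1 - 2 * m) * p 4 ^ (1 - 2 * m - 1))) • pr 4,
      (1 / (m / (2 * m - 1))) •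
          ((2 * p 1 * p 4 ^ (1 - 2 * m) - p 0 * p 4 ^ (1 - m)) • pr 1 +
            (p 1 ^ 2 * ((1 - 2 * m) * p 4 ^ (1 - 2 * m - 1)) -
              p 0 * p 1 * ((1 - m) * p 4 ^ (1 - m - 1))) • pr 4 -
            (p 1 * p 4 ^ (1 - m)) • pr 0) +
        p 3 • pr 0 + p 0 • pr 3 - pr 2,
      (1 / (m / (2 * m - 1))) • (p 4 ^ (-m) • pr 1 +
          (p 1 * (-m * p 4 ^ (-m - 1))) • pr 4) - ((m - 1) / m) • pr 0,
      (-(p 4 ^ 2)⁻¹) • pr 4]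

theorem hasFDerivAt_Tzeta (m : ℝ) (p : Fin 5 → ℝ) (hw : p 4 ≠ 0) :
    HasFDerivAt (Tzeta m) (TzetaDeriv m p) p := by
  have hc (i : Fin 5) : HasFDerivAt (fun q : Fin 5 → ℝ => q i) (pr i) p := (pr i).hasFDerivAt
  have hr (r : ℝ) := (hc 4).rpow_const (p := r) (Or.inl hw)
  rw [hasFDerivAt_pi']
  intro i
  fin_cases i
  · refine ((((hc 1).const_mul _).mul (hr (1 - m))).sub ((hc 3).const_mul _)).congr_fderiv ?_
    ext v
    simp [TzetaDeriv, pr]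
    ring
  · refine ((hc 1).mul (hr (1 - 2 * m))).congr_fderiv ?_
    ext v
    simp [TzetaDeriv, pr]
    ring
  · refine ((((((hc 1).pow 2).mul (hr (1 - 2 * m))).sub
      (((hc 0).mul (hc 1)).mul (hr (1 - m)))).const_mul _).add
        ((hc 0).mul (hc 3)) |>.sub (hc 2)).congr_fderiv ?_
    ext v
    simp [TzetaDeriv, pr]
    ring
  · refine ((((hc 1).const_mul _).mul (hr (-m))).sub ((hc 0).const_mul _)).congr_fderiv ?_
    ext v
    simp [TzetaDeriv, pr]
    ring
  · refine ((hasDerivAt_inv hw).comp_hasFDerivAt p (hc 4)).congr_fderiv ?_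
    ext v
    simp [TzetaDeriv, pr]

/-- For `m ∉ {0, 1/2, 1}`, `T_ζ` is an auto-equivalence of the Monge equation
`P_m : y' = (z'')^m`: the pullback along `DT_ζ(p)` of each 1-form of `P_m` at
`T_ζ(p)` lies in the span of the 1-forms of `P_m` at `p`, for every `p` with
`z₂ > 0`. -/
theorem Tzeta_auto_equivalence (m : ℝ) (h0 : m ≠ 0) (h12 : m ≠ 1 / 2) (h1 : m ≠ 1)
    (p : Fin 5 → ℝ) (hp : p 4 > 0) :
    ∀ i : Fin 3,
      ((mongeForms (fun q => q 4 ^ m) (Tzeta m p) i).comp (fderiv ℝ (Tzeta m) p)) ∈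
        Submodule.span ℝ (Set.range (mongeForms (fun q => q 4 ^ m) p)) := by
  have hd : m - 1 ≠ 0 := sub_ne_zero.mpr h1
  have hm : 2 * m - 1 ≠ 0 := fun h => h12 (by linarith)
  have hw : p 4 ≠ 0 := hp.ne'
  have hP : p 4 ^ m * p 4 ^ (-m) = 1 := by rw [← rpow_add hp]; simp
  have e1 : p 4 ^ (1 - m) = p 4 * p 4 ^ (-m) := by
    rw [sub_eq_add_neg, rpow_add hp, rpow_one]
  have e2 : p 4 ^ (1 - 2 * m) = p 4 * (p 4 ^ (-m) * p 4 ^ (-m)) := by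
    rw [← rpow_add hp, ← rpow_one_add' hp.le (by contrapose! hm; linarith)]
    ring_nf
  have e3 : (p 4)⁻¹ ^ m = p 4 ^ (-m) := by rw [inv_rpow hp.le, rpow_neg hp.le]
  rw [(hasFDerivAt_Tzeta m p hw).fderiv]
  have mem (a b c : ℝ) (φ : (Fin 5 → ℝ) →L[ℝ] ℝ)
      (h : φ = a • mongeForms (fun q => q 4 ^ m) p 0 + b • mongeForms (fun q => q 4 ^ m) p 1 +
        c • mongeForms (fun q => q 4 ^ m) p 2) :
      φ ∈ Submodule.span ℝ (Set.range (mongeForms (fun q => q 4 ^ m) p)) := by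
    have hs (j : Fin 3) := Submodule.subset_span (R := ℝ)
      (Set.mem_range_self (f := mongeForms (fun q => q 4 ^ m) p) j)
    rw [h]
    exact add_mem (add_mem (Submodule.smul_mem _ _ (hs 0)) (Submodule.smul_mem _ _ (hs 1)))
      (Submodule.smul_mem _ _ (hs 2))
  have e4 : p 4 ^ (-(2 * m)) = p 4 ^ (-m) * p 4 ^ (-m) := by
    rw [← rpow_add hp]; ring_nf
  have e5 : p 4 ^ (-m - 1) = p 4 ^ (-m) / p 4 := rpow_sub_one hw _
  have hA : p 4 ^ (-m) ≠ 0 := (rpow_pos_of_pos hp _).ne'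
  have hP' : p 4 ^ m = (p 4 ^ (-m))⁻¹ := eq_inv_of_mul_eq_one_left hP
  intro i
  fin_cases i
  · refine mem (-(m / (m - 1)) * p 4 * (p 4 ^ (-m)) ^ 2) 0 (m / (m - 1) * p 4 ^ (-m)) _ ?_
    ext v
    simp [mongeForms, Tzeta, TzetaDeriv, pr, e1, e2, e3, e4, e5, hP']
    generalize p 4 ^ (-m) = A at *
    field_simp
    ring
  · refine mem (-((2 * m - 1) / (m * (m - 1))) * p 1 * p 4 * (p 4 ^ (-m)) ^ 2) (-1)
      ((2 * m - 1) / (m - 1) * p 1 * p 4 ^ (-m)) _ ?_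
    ext v
    simp [mongeForms, Tzeta, TzetaDeriv, pr, e1, e2, e3, e4, e5, hP']
    generalize p 4 ^ (-m) = A at *
    field_simp
    ring
  · refine mem (-((2 * m - 1) / (m * (m - 1))) * p 4 ^ (-m)) 0 (m / ((m - 1) * p 4)) _ ?_
    ext v
    simp [mongeForms, Tzeta, TzetaDeriv, pr, e1, e2, e3, e4, e5, hP']
    generalize p 4 ^ (-m) = A at *
    field_simp
    ring
end

section
/- Define Ψ̄ : ℝ⁵ → ℝ⁵ by Ψ̄(x, y, z, z₁, z₂) = ( (z₂ − z₁) e^{x}, z₂ − z, (z₂² − z₁²)/2 + z₁ z₂ − y, (z₁ + z₂) e^{−x}, e^{−2x} ). Then the fifth coordinate of Ψ̄(p) is positive for every p ∈ ℝ⁵, and the pullback along DΨ̄(p) of each of the three 1-forms of P_{1/2} (i.e. of the Monge equation y' = √(z''), with f = √z₂) at Ψ̄(p) lies in the linear span of the three 1-forms of the Monge equation y' = (z'')² + (z')² at p. That is, Ψ̄ maps the Monge equation y' = (z'')² + (z')² to P_{1/2}. -/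
open Real

/-- The equivalence `Ψ̄`. -/
noncomputable def PsiBar : (Fin 5 → ℝ) → (Fin 5 → ℝ) :=
  fun p =>
    ![(p 4 - p 3) * Real.exp (p 0),
      p 4 - p 2,
      (p 4 ^ 2 - p 3 ^ 2) / 2 + p 3 * p 4 - p 1,
      (p 3 + p 4) * Real.exp (-p 0),
      Real.exp (-2 * p 0)]

/-- The derivative of `PsiBar` at `p`, written with the coordinate 1-forms. -/
noncomputable def PsiBarDeriv (p : Fin 5 → ℝ) : Fin 5 → ((Fin 5 → ℝ) →L[ℝ] ℝ) :=
  ![Real.exp (p 0) • (pr 4 - pr 3 + (p 4 - p 3) • pr 0),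
    pr 4 - pr 2,
    (p 4 + p 3) • pr 4 + (p 4 - p 3) • pr 3 - pr 1,
    Real.exp (-p 0) • (pr 3 + pr 4 - (p 3 + p 4) • pr 0),
    (-2 * Real.exp (-2 * p 0)) • pr 0]

theorem hasFDerivAt_pr (i : Fin 5) (p : Fin 5 → ℝ) :
    HasFDerivAt (fun q : Fin 5 → ℝ => q i) (pr i) p :=
  (pr i).hasFDerivAt

theorem hasFDerivAt_PsiBar (p : Fin 5 → ℝ) :
    HasFDerivAt PsiBar (ContinuousLinearMap.pi (PsiBarDeriv p)) p := by
  have h (i : Fin 5) := hasFDerivAt_pr i p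
  refine hasFDerivAt_pi.2 fun i => ?_
  fin_cases i
  · refine (((h 4).sub (h 3)).mul (h 0).exp).congr_fderiv ?_
    ext v
    simp [PsiBarDeriv]
    ring
  · exact (h 4).sub (h 2)
  · refine (((((h 4).pow 2).sub ((h 3).pow 2)).mul_const (1 / 2)).add
      ((h 3).mul (h 4)) |>.sub (h 1)).congr_fderiv ?_ |>.congr_of_eventuallyEq ?_
    · ext v
      simp [PsiBarDeriv]
      ring
    · refine .of_forall fun q => ?_
      simp [PsiBar]
      ring
  · refine (((h 3).add (h 4)).mul (h 0).neg.exp).congr_fderiv ?_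
    ext v
    simp [PsiBarDeriv]
    ring
  · refine ((h 0).const_mul (-2)).exp.congr_fderiv ?_
    ext v
    simp [PsiBarDeriv]
    ring

theorem pr_comp_fderiv_PsiBar (i : Fin 5) (p : Fin 5 → ℝ) :
    (pr i).comp (fderiv ℝ PsiBar p) = PsiBarDeriv p i := by
  rw [(hasFDerivAt_PsiBar p).fderiv]
  rfl

theorem sqrt_exp_neg_two_mul (x : ℝ) : √(Real.exp (-2 * x)) = Real.exp (-x) := by
  rw [← Real.exp_half]
  ring_nf

/-- The map `Ψ̄` maps the Monge equation `y' = (z'')² + (z')²` to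
`P_{1/2} : y' = √(z'')`: its fifth coordinate is everywhere positive and the
pullback along `DΨ̄(p)` of each 1-form of `P_{1/2}` at `Ψ̄(p)` lies in the span
of the 1-forms of `y' = (z'')² + (z')²` at `p`. -/
theorem PsiBar_equivalence (p : Fin 5 → ℝ) :
    PsiBar p 4 > 0 ∧
    ∀ i : Fin 3,
      ((mongeForms (fun q => Real.sqrt (q 4)) (PsiBar p) i).comp (fderiv ℝ PsiBar p)) ∈
        Submodule.span ℝ (Set.range (mongeForms (fun q => q 4 ^ 2 + q 3 ^ 2) p)) := by
  refine ⟨Real.exp_pos _, fun i => ?_⟩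
  set ω := mongeForms (fun q => q 4 ^ 2 + q 3 ^ 2) p with hω
  have mem (j : Fin 3) : ω j ∈ Submodule.span ℝ (Set.range ω) :=
    Submodule.subset_span ⟨j, rfl⟩
  have hexp : Real.exp (-p 0) * Real.exp (p 0) = 1 := by
    rw [← Real.exp_add, neg_add_cancel, Real.exp_zero]
  have hexp2 : Real.exp (-2 * p 0) = Real.exp (-p 0) * Real.exp (-p 0) := by
    rw [← Real.exp_add]
    ring_nf
  fin_cases i
  · convert sub_mem (mem 2) (mem 1) using 1
    simp only [mongeForms, hω, Fin.zero_eta, Matrix.cons_val, ContinuousLinearMap.sub_comp,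
      ContinuousLinearMap.smul_comp, pr_comp_fderiv_PsiBar]
    ext v
    simp [PsiBarDeriv, PsiBar, - neg_mul, sqrt_exp_neg_two_mul]
    linear_combination (-(pr 4 v - pr 3 v + (p 4 - p 3) * pr 0 v)) * hexp
  · convert sub_mem (Submodule.smul_mem _ (2 * p 4) (mem 2)) (mem 0) using 1
    simp only [mongeForms, hω, Fin.mk_one, Matrix.cons_val, ContinuousLinearMap.sub_comp,
      ContinuousLinearMap.smul_comp, pr_comp_fderiv_PsiBar]
    ext v
    simp [PsiBarDeriv, PsiBar]
    linear_combination
      (-(p 3 + p 4) * (pr 4 v - pr 3 v + (p 4 - p 3) * pr 0 v)) * hexp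
  · convert Submodule.smul_mem _ (2 * Real.exp (-p 0)) (mem 2) using 1
    simp only [mongeForms, hω, Fin.reduceFinMk, Matrix.cons_val, ContinuousLinearMap.sub_comp,
      ContinuousLinearMap.smul_comp, pr_comp_fderiv_PsiBar]
    ext v
    simp [PsiBarDeriv, PsiBar, - neg_mul, hexp2]
    linear_combination
      (-Real.exp (-p 0) * (pr 4 v - pr 3 v + (p 4 - p 3) * pr 0 v)) * hexp
end

section
/- Define Υ : ℝ⁵ → ℝ⁵ by Υ(x, y, z, z₁, z₂) = ( 2y − x e^{z₂}, x + z₁ − x z₂, 2(x z₁ − z) − x²(z₂ − 1/2), x e^{−z₂}, e^{−2z₂} ). Then the fifth coordinate of Υ(p) is positive for every p ∈ ℝ⁵, and the pullback along DΥ(p) of each of the three 1-forms of P_{1/2} (i.e. of the Monge equation y' = √(z''), with f = √z₂) at Υ(p) lies in the linear span of the three 1-forms of the Monge equation y' = exp(z'') at p. That is, Υ maps the Monge equation y' = exp(z'') to P_{1/2}. -/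
open Real

/-- The equivalence `Υ`. -/
noncomputable def Upsilon : (Fin 5 → ℝ) → (Fin 5 → ℝ) :=
  fun p =>
    ![2 * p 1 - p 0 * Real.exp (p 4),
      p 0 + p 3 - p 0 * p 4,
      2 * (p 0 * p 3 - p 2) - p 0 ^ 2 * (p 4 - 1 / 2),
      p 0 * Real.exp (-p 4),
      Real.exp (-2 * p 4)]

/-- The derivative of `Υ` at `p`, written through the coordinate differentials `pr i`. -/
noncomputable def upsilonDeriv (p : Fin 5 → ℝ) : Fin 5 → ((Fin 5 → ℝ) →L[ℝ] ℝ) :=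
  ![(2 : ℝ) • pr 1 - (exp (p 4) • pr 0 + (p 0 * exp (p 4)) • pr 4),
    (1 - p 4) • pr 0 + pr 3 - p 0 • pr 4,
    (2 * p 3 - 2 * p 0 * (p 4 - 1 / 2)) • pr 0 - (2 : ℝ) • pr 2 + (2 * p 0) • pr 3
      - p 0 ^ 2 • pr 4,
    exp (-p 4) • pr 0 - (p 0 * exp (-p 4)) • pr 4,
    (-2 * exp (-2 * p 4)) • pr 4]

theorem hasFDerivAt_coord (p : Fin 5 → ℝ) (i : Fin 5) :
    HasFDerivAt (fun q : Fin 5 → ℝ => q i) (pr i) p :=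
  (pr i).hasFDerivAt

theorem hasFDerivAt_Upsilon (p : Fin 5 → ℝ) :
    HasFDerivAt Upsilon (ContinuousLinearMap.pi (upsilonDeriv p)) p := by
  have h := hasFDerivAt_coord p
  rw [hasFDerivAt_pi]
  intro i
  fin_cases i
  · refine (((h 1).const_mul 2).sub ((h 0).mul (h 4).exp)).congr_fderiv ?_
    ext v
    simp [upsilonDeriv]
    ring
  · refine (((h 0).add (h 3)).sub ((h 0).mul (h 4))).congr_fderiv ?_
    ext v
    simp [upsilonDeriv]
    ring
  · refine (((((h 0).mul (h 3)).sub (h 2)).const_mul 2).sub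
      (((h 0).pow 2).mul ((h 4).sub_const (1 / 2)))).congr_fderiv ?_
    ext v
    simp [upsilonDeriv]
    ring
  · refine ((h 0).mul (h 4).neg.exp).congr_fderiv ?_
    ext v
    simp [upsilonDeriv]
    ring
  · refine ((h 4).const_mul (-2)).exp.congr_fderiv ?_
    ext v
    simp [upsilonDeriv]
    ring

theorem sqrt_Upsilon_four (p : Fin 5 → ℝ) : √(Upsilon p 4) = exp (-p 4) := by
  have h : Upsilon p 4 = exp (-p 4) ^ 2 := by
    rw [← exp_nat_mul]
    simp [Upsilon]
  rw [h, sqrt_sq (exp_pos _).le]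

/-- Coefficients of the pulled back forms in terms of the forms of `y' = exp(z'')`. -/
noncomputable def pullbackCoeff (p : Fin 5 → ℝ) : Fin 3 → Fin 3 → ℝ :=
  ![![-2 * exp (-p 4), 0, 1],
    ![-2 * p 0 * exp (-p 4), -2, 2 * p 0],
    ![-2 * exp (-p 4) ^ 2, 0, 0]]

theorem mongeForms_comp_fderiv_Upsilon (p : Fin 5 → ℝ) (i : Fin 3) :
    (mongeForms (fun q => √(q 4)) (Upsilon p) i).comp (fderiv ℝ Upsilon p) =
      ∑ j, pullbackCoeff p i j • mongeForms (fun q => exp (q 4)) p j := by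
  have hE : exp (-p 4) * exp (p 4) = 1 := by rw [← exp_add]; simp
  have hsq : exp (-(2 * p 4)) = exp (-p 4) ^ 2 := by
    rw [← exp_nat_mul]
    simp
  rw [(hasFDerivAt_Upsilon p).fderiv]
  ext v
  fin_cases i
  · simp [mongeForms, sqrt_Upsilon_four, Fin.sum_univ_three, pullbackCoeff, upsilonDeriv, pr]
    linear_combination (p 0 * v 4 - v 0) * hE
  · simp [mongeForms, Fin.sum_univ_three, pullbackCoeff, upsilonDeriv, pr, Upsilon]
    linear_combination p 0 * (p 0 * v 4 - v 0) * hE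
  · simp [mongeForms, Fin.sum_univ_three, pullbackCoeff, upsilonDeriv, pr, Upsilon, hsq]
    linear_combination exp (-p 4) * (p 0 * v 4 - v 0) * hE

/-- The map `Υ` maps the Monge equation `y' = exp(z'')` to `P_{1/2} : y' = √(z'')`:
its fifth coordinate is everywhere positive and the pullback along `DΥ(p)` of
each 1-form of `P_{1/2}` at `Υ(p)` lies in the span of the 1-forms of
`y' = exp(z'')` at `p`. -/
theorem Upsilon_equivalence (p : Fin 5 → ℝ) :
    Upsilon p 4 > 0 ∧
    ∀ i : Fin 3,
      ((mongeForms (fun q => Real.sqrt (q 4)) (Upsilon p) i).comp (fderiv ℝ Upsilon p)) ∈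
        Submodule.span ℝ (Set.range (mongeForms (fun q => Real.exp (q 4)) p)) := by
  refine ⟨exp_pos _, fun i => ?_⟩
  rw [mongeForms_comp_fderiv_Upsilon]
  exact Submodule.sum_mem _ fun j _ =>
    Submodule.smul_mem _ _ (Submodule.subset_span (Set.mem_range_self j))
end

section
/- Let m be real with m ∉ {0, 1/2}. On the open set {z₂ > 0} ⊂ ℝ⁵ (coordinates x, y, z, z₁, z₂), consider the vector fields W₁ = ∂_x, W₂ = ∂_y, W₃ = ∂_z, W₅ = x ∂_z + ∂_{z₁}, and W₇ = z₂^{m−1} ∂_x + ((m−1)/(2m−1)) z₂^{2m−1} ∂_y + (z₁ z₂^{m−1} − y/m) ∂_z + (1 − 1/m) z₂^{m} ∂_{z₁}. Then their pairwise Lie brackets satisfy: [W₁, W₅] = W₃, [W₂, W₇] = −(1/m) W₃, and all other brackets among W₁, W₂, W₃, W₅, W₇ vanish ([W₁,W₂] = [W₁,W₃] = [W₁,W₇] = [W₂,W₃] = [W₂,W₅] = [W₃,W₅] = [W₃,W₇] = [W₅,W₇] = 0). Hence these five fields span a 5-dimensional Heisenberg Lie algebra of vector fields. -/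
open Real

/-- The Lie bracket of vector fields on (an open subset of) `ℝ⁵`:
`[V, W](p) = DW(p)·V(p) - DV(p)·W(p)`. -/
noncomputable def lieB (V W : (Fin 5 → ℝ) → (Fin 5 → ℝ)) (p : Fin 5 → ℝ) : Fin 5 → ℝ :=
  fderiv ℝ W p (V p) - fderiv ℝ V p (W p)

/-- `W₁ = ∂_x`. -/
noncomputable def W1 : (Fin 5 → ℝ) → (Fin 5 → ℝ) := fun _ => ![1, 0, 0, 0, 0]
/-- `W₂ = ∂_y`. -/
noncomputable def W2 : (Fin 5 → ℝ) → (Fin 5 → ℝ) := fun _ => ![0, 1, 0, 0, 0]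
/-- `W₃ = ∂_z`. -/
noncomputable def W3 : (Fin 5 → ℝ) → (Fin 5 → ℝ) := fun _ => ![0, 0, 1, 0, 0]
/-- `W₅ = x ∂_z + ∂_{z₁}`. -/
noncomputable def W5 : (Fin 5 → ℝ) → (Fin 5 → ℝ) := fun p => ![0, 0, p 0, 1, 0]
/-- `W₇ = z₂^{m-1} ∂_x + ((m-1)/(2m-1)) z₂^{2m-1} ∂_y + (z₁ z₂^{m-1} - y/m) ∂_z
      + (1 - 1/m) z₂^m ∂_{z₁}`. -/
noncomputable def W7 (m : ℝ) : (Fin 5 → ℝ) → (Fin 5 → ℝ) :=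
  fun p =>
    ![p 4 ^ (m - 1),
      ((m - 1) / (2 * m - 1)) * p 4 ^ (2 * m - 1),
      p 3 * p 4 ^ (m - 1) - p 1 / m,
      (1 - 1 / m) * p 4 ^ m,
      0]

lemma fderiv_W5 (p v : Fin 5 → ℝ) : fderiv ℝ W5 p v = ![0, 0, v 0, 0, 0] := by
  have h : HasFDerivAt W5
      (ContinuousLinearMap.pi (![0, 0, ContinuousLinearMap.proj 0, 0, 0] :
        Fin 5 → (Fin 5 → ℝ) →L[ℝ] ℝ)) p := by
    rw [hasFDerivAt_pi']
    intro i
    fin_cases i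
    all_goals first
      | exact hasFDerivAt_const _ _
      | exact hasFDerivAt_apply 0 p
  rw [h.fderiv]
  ext i
  fin_cases i <;> rfl

lemma differentiableAt_W7 (m : ℝ) {p : Fin 5 → ℝ} (hp : 0 < p 4) :
    DifferentiableAt ℝ (W7 m) p := by
  have h (r : ℝ) : DifferentiableAt ℝ (fun q : Fin 5 → ℝ => q 4 ^ r) p :=
    (differentiableAt_apply 4 p).rpow_const (Or.inl hp.ne')
  have h₁ := h (m - 1)
  have h₂ := h (2 * m - 1)
  have h₃ := h m
  rw [differentiableAt_pi]
  intro i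
  fin_cases i <;> simp only [W7] <;> simp <;> fun_prop

/-- The derivative of `W7 m` in a direction with no `∂_{z₂}` component, along which it is affine. -/
lemma fderiv_W7 (m : ℝ) {p v : Fin 5 → ℝ} (hp : 0 < p 4) (hv : v 4 = 0) :
    fderiv ℝ (W7 m) p v = ![0, 0, v 3 * p 4 ^ (m - 1) - v 1 / m, 0, 0] := by
  rw [← (differentiableAt_W7 m hp).lineDeriv_eq_fderiv]
  have h : (fun t : ℝ => W7 m (p + t • v)) =
      fun t => W7 m p + t • ![0, 0, v 3 * p 4 ^ (m - 1) - v 1 / m, 0, 0] := by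
    funext t i
    fin_cases i <;> simp [W7, hv]
    ring
  rw [lineDeriv, h]
  simpa using (((hasDerivAt_id (0 : ℝ)).smul_const
    (![0, 0, v 3 * p 4 ^ (m - 1) - v 1 / m, 0, 0] : Fin 5 → ℝ)).const_add (W7 m p)).deriv

/-- For `m ∉ {0, 1/2}`, the symmetry fields `W₁, W₂, W₃, W₅, W₇` of
`P_m : y' = (z'')^m` on `{z₂ > 0}` satisfy the Heisenberg relations
`[W₁, W₅] = W₃`, `[W₂, W₇] = -(1/m) W₃`, with all other brackets vanishing;
hence they span a 5-dimensional Heisenberg Lie algebra of vector fields. -/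
theorem heisenberg_relations (m : ℝ) (h0 : m ≠ 0) (h12 : m ≠ 1 / 2)
    (p : Fin 5 → ℝ) (hp : p 4 > 0) :
    lieB W1 W5 p = W3 p ∧
    lieB W2 (W7 m) p = -(1 / m) • W3 p ∧
    lieB W1 W2 p = 0 ∧ lieB W1 W3 p = 0 ∧ lieB W1 (W7 m) p = 0 ∧
    lieB W2 W3 p = 0 ∧ lieB W2 W5 p = 0 ∧
    lieB W3 W5 p = 0 ∧ lieB W3 (W7 m) p = 0 ∧
    lieB W5 (W7 m) p = 0 := by
  have h₁ : fderiv ℝ W1 p = 0 := fderiv_const_apply _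
  have h₂ : fderiv ℝ W2 p = 0 := fderiv_const_apply _
  have h₃ : fderiv ℝ W3 p = 0 := fderiv_const_apply _
  have e₁ : W1 p 4 = 0 := rfl
  have e₂ : W2 p 4 = 0 := rfl
  have e₃ : W3 p 4 = 0 := rfl
  have e₅ : W5 p 4 = 0 := rfl
  simp only [lieB, h₁, h₂, h₃, fderiv_W5, fderiv_W7 m hp e₁, fderiv_W7 m hp e₂,
    fderiv_W7 m hp e₃, fderiv_W7 m hp e₅]
  refine ⟨?_, ?_, ?_, ?_, ?_, ?_, ?_, ?_, ?_, ?_⟩ <;> ext i <;> fin_cases i <;>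
    simp [W1, W2, W3, W5, W7]
end

section
/- Let a, b be real numbers. For real parameters c, d define the vector field ξ(c, d) = e^{d x} ( ∂_z + d ∂_{z₁} + d² ∂_{z₂} + 2d(c² z + d z₁) ∂_y ) on ℝ⁵. Then each of the four vector fields ξ(a, b), ξ(−a, −b), ξ(b, a), ξ(−b, −a) is an infinitesimal symmetry of the rank-2 distribution of the Monge equation Q_{ab} : y' = (z'')² + (a² + b²)(z')² + a² b² z²; that is, for each such field U and every point p ∈ ℝ⁵, the Lie brackets [U, ∂_{z₂}](p) and [U, X](p), where X = ∂_x + (z₂² + (a²+b²) z₁² + a²b² z²) ∂_y + z₁ ∂_z + z₂ ∂_{z₁}, lie in the linear span of ∂_{z₂}(p) and X(p). -/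
open Real

/-- The vertical field `∂_{z₂}` of the rank-2 distribution. -/
noncomputable def Dz2 : (Fin 5 → ℝ) → (Fin 5 → ℝ) := fun _ => ![0, 0, 0, 0, 1]

/-- The symmetry field
`ξ(c, d) = e^{dx}(∂_z + d ∂_{z₁} + d² ∂_{z₂} + 2d(c² z + d z₁) ∂_y)`. -/
noncomputable def xi (c d : ℝ) : (Fin 5 → ℝ) → (Fin 5 → ℝ) :=
  fun p =>
    ![0,
      Real.exp (d * p 0) * (2 * d * (c ^ 2 * p 2 + d * p 3)),
      Real.exp (d * p 0),
      d * Real.exp (d * p 0),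
      d ^ 2 * Real.exp (d * p 0)]

/-- The total-derivative field
`X = ∂_x + (z₂² + (a²+b²)z₁² + a²b² z²) ∂_y + z₁ ∂_z + z₂ ∂_{z₁}` of
`Q_{ab} : y' = (z'')² + (a²+b²)(z')² + a²b² z²`. -/
noncomputable def XQ (a b : ℝ) : (Fin 5 → ℝ) → (Fin 5 → ℝ) :=
  fun p =>
    ![1,
      p 4 ^ 2 + (a ^ 2 + b ^ 2) * p 3 ^ 2 + a ^ 2 * b ^ 2 * p 2 ^ 2,
      p 3,
      p 4,
      0]

/-- A vector field on `ℝ⁵` is differentiated coordinatewise along the line `t ↦ p + t • v`. -/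
lemma fderiv_apply_eq_of_hasDerivAt {F : (Fin 5 → ℝ) → (Fin 5 → ℝ)} {p v w : Fin 5 → ℝ}
    (hF : DifferentiableAt ℝ F p)
    (h : ∀ i, HasDerivAt (fun t : ℝ => F (p + t • v) i) (w i) 0) :
    fderiv ℝ F p v = w := by
  rw [← hF.lineDeriv_eq_fderiv]
  exact HasLineDerivAt.lineDeriv (hasDerivAt_pi.2 h)

lemma differentiable_xi (c d : ℝ) : Differentiable ℝ (xi c d) := by
  refine differentiable_pi.2 fun i => ?_
  fin_cases i <;> simp only [xi] <;> simp <;> fun_prop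

lemma differentiable_XQ (a b : ℝ) : Differentiable ℝ (XQ a b) := by
  refine differentiable_pi.2 fun i => ?_
  fin_cases i <;> simp only [XQ] <;> simp <;> fun_prop

lemma hasDerivAt_coord_line (p v : Fin 5 → ℝ) (j : Fin 5) :
    HasDerivAt (fun t : ℝ => p j + t * v j) (v j) 0 := by
  simpa using ((hasDerivAt_id (0 : ℝ)).mul_const (v j)).const_add (p j)

lemma fderiv_xi_apply (c d : ℝ) (p v : Fin 5 → ℝ) :
    fderiv ℝ (xi c d) p v = Real.exp (d * p 0) •
      ![0,
        d * v 0 * (2 * d * (c ^ 2 * p 2 + d * p 3)) + 2 * d * (c ^ 2 * v 2 + d * v 3),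
        d * v 0,
        d ^ 2 * v 0,
        d ^ 3 * v 0] := by
  have hx := hasDerivAt_coord_line p v
  have he := ((hx 0).const_mul d).exp
  refine fderiv_apply_eq_of_hasDerivAt (differentiable_xi c d p) fun i => ?_
  fin_cases i
  · simpa [xi] using hasDerivAt_const (0 : ℝ) (0 : ℝ)
  · refine HasDerivAt.congr_deriv
      (he.mul ((((hx 2).const_mul (c ^ 2)).add ((hx 3).const_mul d)).const_mul (2 * d))) ?_
    simp
    ring
  · refine HasDerivAt.congr_deriv he ?_
    simp
  · refine HasDerivAt.congr_deriv (he.const_mul d) ?_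
    simp
    ring
  · refine HasDerivAt.congr_deriv (he.const_mul (d ^ 2)) ?_
    simp
    ring

lemma fderiv_XQ_apply (a b : ℝ) (p v : Fin 5 → ℝ) :
    fderiv ℝ (XQ a b) p v =
      ![0,
        2 * p 4 * v 4 + 2 * (a ^ 2 + b ^ 2) * p 3 * v 3 + 2 * (a ^ 2 * b ^ 2) * p 2 * v 2,
        v 3,
        v 4,
        0] := by
  have hx := hasDerivAt_coord_line p v
  refine fderiv_apply_eq_of_hasDerivAt (differentiable_XQ a b p) fun i => ?_
  fin_cases i
  · simpa [XQ] using hasDerivAt_const (0 : ℝ) (1 : ℝ)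
  · refine HasDerivAt.congr_deriv
      ((((hx 4).pow 2).add (((hx 3).pow 2).const_mul (a ^ 2 + b ^ 2))).add
      (((hx 2).pow 2).const_mul (a ^ 2 * b ^ 2))) ?_
    simp
    ring
  · exact hx 3
  · exact hx 4
  · simpa [XQ] using hasDerivAt_const (0 : ℝ) (0 : ℝ)

lemma lieB_xi_Dz2 (c d : ℝ) (p : Fin 5 → ℝ) : lieB (xi c d) Dz2 p = 0 := by
  have h : fderiv ℝ Dz2 p = 0 := fderiv_const_apply _
  rw [lieB, h, fderiv_xi_apply]
  ext i
  fin_cases i <;> simp [Dz2]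

lemma lieB_xi_XQ {a b c d : ℝ} (hs : c ^ 2 + d ^ 2 = a ^ 2 + b ^ 2)
    (hm : c ^ 2 * d ^ 2 = a ^ 2 * b ^ 2) (p : Fin 5 → ℝ) :
    lieB (xi c d) (XQ a b) p = (-(d ^ 3 * Real.exp (d * p 0))) • Dz2 p := by
  rw [lieB, fderiv_xi_apply, fderiv_XQ_apply, ← hs, ← hm]
  ext i
  fin_cases i <;> simp [Dz2, xi, XQ] <;> ring

/-- Each of the four fields `ξ(a,b), ξ(-a,-b), ξ(b,a), ξ(-b,-a)` is an
infinitesimal symmetry of the rank-2 distribution `⟨∂_{z₂}, X⟩` of the Monge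
equation `Q_{ab} : y' = (z'')² + (a²+b²)(z')² + a²b² z²`: both brackets
`[U, ∂_{z₂}]` and `[U, X]` lie pointwise in the span of `∂_{z₂}` and `X`. -/
theorem xi_infinitesimal_symmetries (a b : ℝ) (c d : ℝ)
    (hcd : (c, d) = (a, b) ∨ (c, d) = (-a, -b) ∨ (c, d) = (b, a) ∨ (c, d) = (-b, -a))
    (p : Fin 5 → ℝ) :
    lieB (xi c d) Dz2 p ∈ Submodule.span ℝ ({Dz2 p, XQ a b p} : Set (Fin 5 → ℝ)) ∧
    lieB (xi c d) (XQ a b) p ∈ Submodule.span ℝ ({Dz2 p, XQ a b p} : Set (Fin 5 → ℝ)) := by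
  obtain ⟨hs, hm⟩ : c ^ 2 + d ^ 2 = a ^ 2 + b ^ 2 ∧ c ^ 2 * d ^ 2 = a ^ 2 * b ^ 2 := by
    simp only [Prod.mk.injEq] at hcd
    rcases hcd with ⟨rfl, rfl⟩ | ⟨rfl, rfl⟩ | ⟨rfl, rfl⟩ | ⟨rfl, rfl⟩ <;> constructor <;> ring
  rw [lieB_xi_Dz2, lieB_xi_XQ hs hm]
  exact ⟨Submodule.zero_mem _, Submodule.smul_mem _ _ (Submodule.subset_span (by simp))⟩
end
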